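/- arXiv:2002.06482 — 4 statements merged into one kernel-verified Lean document; each statement's English description precedes it below -/
import Mathlib

section
/- Let c ≥ 2 be an integer, let 0 ≤ t1 < 1, and let L be the Bi-Tempered classification loss L_Bi with parameter t1. Let 0 ≤ η ≤ 1 − 1/c. Suppose f* is a global minimizer of the clean risk R_L over all measurable classifiers and f̂ is a global minimizer of the symmetric-noise risk R_L^η over all measurable classifiers. Then 0 ≤ R_L^η(f*) − R_L^η(f̂) ≤ A, where A = η/(1−t1) − η(c − c^{t1}) / ((c−1)(1−t1)(2−t1)). -/
open MeasureTheory

/-- A prediction: a probability vector over `c` classes. -/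
def IsPred (c : ℕ) (p : Fin c → ℝ) : Prop :=
  (∀ j, 0 ≤ p j) ∧ ∑ j, p j = 1

/-- A classifier: a measurable map into the set of predictions. -/
def IsClassifier {X : Type*} [MeasurableSpace X] (c : ℕ) (f : X → Fin c → ℝ) : Prop :=
  Measurable f ∧ ∀ x, IsPred c (f x)

/-- Clean risk `R_L(f) = E_{(x,y)∼μ}[L(f(x), y)]`. -/
noncomputable def cleanRisk {X : Type*} [MeasurableSpace X] {c : ℕ}
    (μ : Measure (X × Fin c)) (L : (Fin c → ℝ) → Fin c → ℝ) (f : X → Fin c → ℝ) : ℝ :=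
  ∫ z, L (f z.1) z.2 ∂μ

/-- Risk under symmetric label noise of rate `η`:
`R_L^η(f) = E[(1−η)·L(f(x), y) + (η/(c−1))·Σ_{j≠y} L(f(x), j)]`. -/
noncomputable def noisyRisk {X : Type*} [MeasurableSpace X] {c : ℕ}
    (μ : Measure (X × Fin c)) (L : (Fin c → ℝ) → Fin c → ℝ) (η : ℝ)
    (f : X → Fin c → ℝ) : ℝ :=
  ∫ z, ((1 - η) * L (f z.1) z.2
    + (η / ((c : ℝ) - 1)) * ∑ j ∈ Finset.univ.erase z.2, L (f z.1) j) ∂μ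

/-- Tempered logarithm `log_t(x) = (x^{1−t} − 1)/(1−t)` (real rpow gives `0^{1−t} = 0` for `t < 1`). -/
noncomputable def tLog (t x : ℝ) : ℝ := (x ^ (1 - t) - 1) / (1 - t)

/-- The Bi-Tempered loss `L_Bi(p, j) = −log_{t1}(p_j) + (1/(2−t1))·(1 − Σ_k p_k^{2−t1})`. -/
noncomputable def biLoss {c : ℕ} (t1 : ℝ) (p : Fin c → ℝ) (j : Fin c) : ℝ :=
  -tLog t1 (p j) + (1 / (2 - t1)) * (1 - ∑ k, (p k) ^ (2 - t1))

namespace IsPred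

variable {c : ℕ} {p : Fin c → ℝ}

theorem le_one (hp : IsPred c p) (j : Fin c) : p j ≤ 1 :=
  hp.2 ▸ Finset.single_le_sum (fun i _ => hp.1 i) (Finset.mem_univ j)

theorem one_le_sum_rpow (hp : IsPred c p) {s : ℝ} (hs0 : 0 < s) (hs1 : s ≤ 1) :
    1 ≤ ∑ j, p j ^ s := by
  rw [← hp.2]
  refine Finset.sum_le_sum fun j _ => ?_
  rcases (hp.1 j).eq_or_lt with h | h
  · simp [← h, Real.zero_rpow hs0.ne']
  · simpa using Real.rpow_le_rpow_of_exponent_ge h (hp.le_one j) hs1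

theorem sum_rpow_le_one (hp : IsPred c p) {s : ℝ} (hs : 1 ≤ s) : ∑ j, p j ^ s ≤ 1 := by
  rw [← hp.2]
  refine Finset.sum_le_sum fun j _ => ?_
  rcases (hp.1 j).eq_or_lt with h | h
  · simp [← h, Real.zero_rpow (zero_lt_one.trans_le hs).ne']
  · simpa using Real.rpow_le_rpow_of_exponent_ge h (hp.le_one j) hs

theorem card_rpow_le_sum_rpow (hc : 0 < c) (hp : IsPred c p) {s : ℝ} (hs : 1 ≤ s) :
    (c : ℝ) ^ (1 - s) ≤ ∑ j, p j ^ s := by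
  have hc' : (0 : ℝ) < c := by exact_mod_cast hc
  have h := Real.rpow_sum_le_const_mul_sum_rpow Finset.univ p hs
  simp only [abs_of_nonneg (hp.1 _), hp.2, Real.one_rpow, Finset.card_univ, Fintype.card_fin] at h
  calc (c : ℝ) ^ (1 - s) ≤ (c : ℝ) ^ (1 - s) * ((c : ℝ) ^ (s - 1) * ∑ j, p j ^ s) :=
        le_mul_of_one_le_right (by positivity) h
    _ = ∑ j, p j ^ s := by
        rw [← mul_assoc, ← Real.rpow_add hc']
        simp

theorem sum_rpow_le_card_rpow (hp : IsPred c p) {s : ℝ} (hs0 : 0 < s) (hs1 : s ≤ 1) :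
    ∑ j, p j ^ s ≤ (c : ℝ) ^ (1 - s) := by
  have h := Real.rpow_sum_le_const_mul_sum_rpow Finset.univ (fun j => p j ^ s)
    ((one_le_inv₀ hs0).2 hs1)
  have hnn : 0 ≤ ∑ j, p j ^ s := Finset.sum_nonneg fun j _ => Real.rpow_nonneg (hp.1 j) s
  simp only [abs_of_nonneg (Real.rpow_nonneg (hp.1 _) s), Real.rpow_rpow_inv (hp.1 _) hs0.ne',
    hp.2, mul_one, Finset.card_univ, Fintype.card_fin] at h
  have h' := Real.rpow_le_rpow (Real.rpow_nonneg hnn _) h hs0.le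
  rwa [Real.rpow_inv_rpow hnn hs0.ne', ← Real.rpow_mul (Nat.cast_nonneg c), sub_mul, one_mul,
    inv_mul_cancel₀ hs0.ne'] at h'

theorem abs_biLoss_le (hp : IsPred c p) {t : ℝ} (ht1 : t < 1) (j : Fin c) :
    |biLoss t p j| ≤ 1 / (1 - t) + 1 / (2 - t) := by
  have h1 : 0 ≤ p j ^ (1 - t) := Real.rpow_nonneg (hp.1 j) _
  have h2 : p j ^ (1 - t) ≤ 1 := Real.rpow_le_one (hp.1 j) (hp.le_one j) (by linarith)
  have h3 : 0 ≤ ∑ k, p k ^ (2 - t) := Finset.sum_nonneg fun k _ => Real.rpow_nonneg (hp.1 k) _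
  have h4 : ∑ k, p k ^ (2 - t) ≤ 1 := hp.sum_rpow_le_one (by linarith)
  have ha : 0 < 1 / (1 - t) := by rw [one_div_pos]; linarith
  have hb : 0 < 1 / (2 - t) := by rw [one_div_pos]; linarith
  have e : biLoss t p j =
      1 / (1 - t) * (1 - p j ^ (1 - t)) + 1 / (2 - t) * (1 - ∑ k, p k ^ (2 - t)) := by
    unfold biLoss tLog
    ring
  rw [e, abs_of_nonneg (by apply add_nonneg <;> apply mul_nonneg <;> linarith)]
  gcongr <;> apply mul_le_of_le_one_right <;> linarith

/-- The oscillation over the simplex of the Bi-Tempered loss summed over all labels. -/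
theorem sum_biLoss_sub_sum_biLoss_le {q : Fin c → ℝ} (hc : 0 < c) (hp : IsPred c p)
    (hq : IsPred c q) {t : ℝ} (ht0 : 0 ≤ t) (ht1 : t < 1) :
    ∑ j, biLoss t p j - ∑ j, biLoss t q j ≤
      1 / (1 - t) * ((c : ℝ) ^ t - 1) + 1 / (2 - t) * ((c : ℝ) - (c : ℝ) ^ t) := by
  have hc' : (0 : ℝ) < c := by exact_mod_cast hc
  have sum_eq : ∀ r : Fin c → ℝ, ∑ j, biLoss t r j =
      1 / (1 - t) * (c - ∑ j, r j ^ (1 - t)) + 1 / (2 - t) * (c - c * ∑ j, r j ^ (2 - t)) := by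
    intro r
    simp only [biLoss, tLog, Finset.sum_add_distrib, Finset.sum_neg_distrib, ← Finset.sum_div,
      Finset.sum_sub_distrib, Finset.sum_const, Finset.card_univ, Fintype.card_fin, nsmul_eq_mul]
    ring
  have h1 := hp.one_le_sum_rpow (s := 1 - t) (by linarith) (by linarith)
  have h2 := hq.sum_rpow_le_card_rpow (s := 1 - t) (by linarith) (by linarith)
  have h3 := hp.card_rpow_le_sum_rpow hc (s := 2 - t) (by linarith)
  have h4 := hq.sum_rpow_le_one (s := 2 - t) (by linarith)
  rw [sub_sub_cancel] at h2
  have h5 : (c : ℝ) ^ t ≤ c * ∑ j, p j ^ (2 - t) := by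
    calc (c : ℝ) ^ t = c * (c : ℝ) ^ (1 - (2 - t)) := by
          rw [mul_comm, ← Real.rpow_add_one hc'.ne']
          congr 1
          ring
      _ ≤ _ := by gcongr
  have h6 : c * ∑ j, q j ^ (2 - t) ≤ c := mul_le_of_le_one_right hc'.le h4
  rw [sum_eq, sum_eq, add_sub_add_comm, ← mul_sub, ← mul_sub]
  have ha : 0 < 1 / (1 - t) := by rw [one_div_pos]; linarith
  have hb : 0 < 1 / (2 - t) := by rw [one_div_pos]; linarith
  gcongr ?_ * ?_ + ?_ * ?_ <;> linarith

end IsPred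

section Risk

variable {X : Type*} [MeasurableSpace X] {c : ℕ} {f : X → Fin c → ℝ}

theorem IsClassifier.measurable_biLoss (hf : IsClassifier c f) (t : ℝ) (j : Fin c) :
    Measurable fun x => biLoss t (f x) j := by
  have h := measurable_pi_iff.1 hf.1
  unfold biLoss tLog
  fun_prop

theorem IsClassifier.integrable_biLoss (hf : IsClassifier c f) (μ : Measure (X × Fin c))
    [IsFiniteMeasure μ] {t : ℝ} (ht1 : t < 1) :
    Integrable (fun z => biLoss t (f z.1) z.2) μ :=
  .of_bound (measurable_from_prod_countable_left (hf.measurable_biLoss t)).aestronglyMeasurable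
    _ (.of_forall fun z => (hf.2 z.1).abs_biLoss_le ht1 z.2)

theorem IsClassifier.integrable_sum_biLoss (hf : IsClassifier c f) (μ : Measure (X × Fin c))
    [IsFiniteMeasure μ] {t : ℝ} (ht1 : t < 1) :
    Integrable (fun z => ∑ j, biLoss t (f z.1) j) μ :=
  integrable_finsetSum _ fun j _ =>
    .of_bound ((hf.measurable_biLoss t j).comp measurable_fst).aestronglyMeasurable
      _ (.of_forall fun z => (hf.2 z.1).abs_biLoss_le ht1 j)

theorem noisyRisk_eq_cleanRisk_add (μ : Measure (X × Fin c)) {L : (Fin c → ℝ) → Fin c → ℝ}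
    (hL : Integrable (fun z => L (f z.1) z.2) μ)
    (hS : Integrable (fun z => ∑ j, L (f z.1) j) μ) (η : ℝ) :
    noisyRisk μ L η f = (1 - η - η / ((c : ℝ) - 1)) * cleanRisk μ L f
      + η / ((c : ℝ) - 1) * ∫ z, ∑ j, L (f z.1) j ∂μ := by
  unfold noisyRisk cleanRisk
  rw [← integral_const_mul, ← integral_const_mul,
    ← integral_add (hL.const_mul _) (hS.const_mul _)]
  refine integral_congr_ae (.of_forall fun z => ?_)
  dsimp only
  rw [← Finset.add_sum_erase _ _ (Finset.mem_univ z.2)]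
  ring

end Risk

/-- Theorem 2 (first part): noisy-risk bound for the Bi-Tempered loss under symmetric noise. -/
theorem biTempered_noisyRisk_bound {X : Type*} [MeasurableSpace X] {c : ℕ} (hc : 2 ≤ c)
    (μ : Measure (X × Fin c)) [IsProbabilityMeasure μ]
    (t1 η : ℝ) (ht0 : 0 ≤ t1) (ht1 : t1 < 1)
    (hη0 : 0 ≤ η) (hη1 : η ≤ 1 - 1 / (c : ℝ))
    (fstar fhat : X → Fin c → ℝ)
    (hfstar : IsClassifier c fstar) (hfhat : IsClassifier c fhat)
    (hmin_clean : ∀ g, IsClassifier c g →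
      cleanRisk μ (biLoss t1) fstar ≤ cleanRisk μ (biLoss t1) g)
    (hmin_noisy : ∀ g, IsClassifier c g →
      noisyRisk μ (biLoss t1) η fhat ≤ noisyRisk μ (biLoss t1) η g) :
    0 ≤ noisyRisk μ (biLoss t1) η fstar - noisyRisk μ (biLoss t1) η fhat ∧
    noisyRisk μ (biLoss t1) η fstar - noisyRisk μ (biLoss t1) η fhat ≤
      η / (1 - t1) - η * ((c : ℝ) - (c : ℝ) ^ t1) / (((c : ℝ) - 1) * (1 - t1) * (2 - t1)) := by
  refine ⟨sub_nonneg.2 (hmin_noisy fstar hfstar), ?_⟩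
  have hc1 : (0 : ℝ) < (c : ℝ) - 1 := by
    have : (2 : ℝ) ≤ c := by exact_mod_cast hc
    linarith
  have hS := hfstar.integrable_sum_biLoss μ ht1
  have hS' := hfhat.integrable_sum_biLoss μ ht1
  rw [noisyRisk_eq_cleanRisk_add μ (hfstar.integrable_biLoss μ ht1) hS,
    noisyRisk_eq_cleanRisk_add μ (hfhat.integrable_biLoss μ ht1) hS']
  have hcoef : 0 ≤ 1 - η - η / ((c : ℝ) - 1) := by
    have h : η * c ≤ c - 1 := by
      have := mul_le_mul_of_nonneg_right hη1 (Nat.cast_nonneg (α := ℝ) c)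
      rwa [sub_mul, one_div_mul_cancel (by linarith), one_mul] at this
    rw [sub_nonneg, div_le_iff₀ hc1]
    linarith
  have hclean := mul_le_mul_of_nonneg_left (hmin_clean fhat hfhat) hcoef
  have hosc : ∫ z, ∑ j, biLoss t1 (fstar z.1) j ∂μ - ∫ z, ∑ j, biLoss t1 (fhat z.1) j ∂μ ≤
      1 / (1 - t1) * ((c : ℝ) ^ t1 - 1) + 1 / (2 - t1) * ((c : ℝ) - (c : ℝ) ^ t1) := by
    rw [← integral_sub hS hS']
    refine (integral_mono (hS.sub hS') (integrable_const _) fun z =>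
      (hfstar.2 z.1).sum_biLoss_sub_sum_biLoss_le (by lia) (hfhat.2 z.1) ht0 ht1).trans_eq ?_
    simp
  have hsum := mul_le_mul_of_nonneg_left hosc (div_nonneg hη0 hc1.le)
  have hbound : η / (1 - t1) -
        η * ((c : ℝ) - (c : ℝ) ^ t1) / (((c : ℝ) - 1) * (1 - t1) * (2 - t1)) =
      η / ((c : ℝ) - 1) *
        (1 / (1 - t1) * ((c : ℝ) ^ t1 - 1) + 1 / (2 - t1) * ((c : ℝ) - (c : ℝ) ^ t1)) := by
    have h1 : 1 - t1 ≠ 0 := by linarith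
    have h2 : 2 - t1 ≠ 0 := by linarith
    field_simp
    ring
  rw [hbound]
  linarith
end

section
/- Let c ≥ 2 be an integer, L(p, j) a bounded measurable loss on predictions and labels, and 0 ≤ η < 1. For every measurable classifier f, the symmetric-noise risk decomposes as R_L^η(f) = (1 − ηc/(c−1))·R_L(f) + (η/(c−1))·E_{(x,y)∼μ}[Σ_{j=1}^c L(f(x), j)]. -/
open MeasureTheory

/-- A loss bounded on predictions is integrable along a classifier and a measurable choice of
labels. -/
theorem IsClassifier.integrable_loss {X : Type*} [MeasurableSpace X] {c : ℕ}
    {f : X → Fin c → ℝ} (hf : IsClassifier c f)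
    (μ : Measure (X × Fin c)) [IsFiniteMeasure μ]
    {L : (Fin c → ℝ) → Fin c → ℝ}
    (hLmeas : Measurable fun pj : (Fin c → ℝ) × Fin c => L pj.1 pj.2)
    (hLbd : ∃ B : ℝ, ∀ p : Fin c → ℝ, IsPred c p → ∀ j, |L p j| ≤ B)
    {g : X × Fin c → Fin c} (hg : Measurable g) :
    Integrable (fun z => L (f z.1) (g z)) μ := by
  obtain ⟨B, hB⟩ := hLbd
  exact Integrable.of_bound
    (hLmeas.comp ((hf.1.comp measurable_fst).prodMk hg)).aestronglyMeasurable B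
    (.of_forall fun z => hB _ (hf.2 z.1) _)

/-- Decomposition of the symmetric-noise risk in terms of the clean risk. -/
theorem noisyRisk_eq_decomposition {X : Type*} [MeasurableSpace X] {c : ℕ} (hc : 2 ≤ c)
    (μ : Measure (X × Fin c)) [IsProbabilityMeasure μ]
    (L : (Fin c → ℝ) → Fin c → ℝ)
    (hLmeas : Measurable fun pj : (Fin c → ℝ) × Fin c => L pj.1 pj.2)
    (hLbd : ∃ B : ℝ, ∀ p : Fin c → ℝ, IsPred c p → ∀ j, |L p j| ≤ B)
    (η : ℝ) (hη0 : 0 ≤ η) (hη1 : η < 1)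
    (f : X → Fin c → ℝ) (hf : IsClassifier c f) :
    noisyRisk μ L η f =
      (1 - η * c / ((c : ℝ) - 1)) * cleanRisk μ L f
        + (η / ((c : ℝ) - 1)) * ∫ z, ∑ j, L (f z.1) j ∂μ := by
  have hc' : (c : ℝ) - 1 ≠ 0 := by
    have : (2 : ℝ) ≤ c := by exact_mod_cast hc
    linarith
  have hclean := hf.integrable_loss μ hLmeas hLbd measurable_snd
  have hsum : Integrable (fun z : X × Fin c => ∑ j, L (f z.1) j) μ :=
    integrable_finsetSum _ fun j _ => hf.integrable_loss μ hLmeas hLbd (measurable_const (a := j))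
  rw [noisyRisk, cleanRisk, ← integral_const_mul, ← integral_const_mul,
    ← integral_add (hclean.const_mul _) (hsum.const_mul _)]
  congr 1 with z
  rw [Finset.sum_erase_eq_sub (Finset.mem_univ z.2)]
  field_simp
  ring
end

section
/- Let c ≥ 2 be an integer, λ > 0, d > 1. For every prediction p with p_j > 0 for all j, the sum of the PolySoft classification losses over all labels satisfies Σ_{j=1}^c ℓ_{λ,d}(−log p_j) ≥ ((d−1)/d)·min(c·log c, λ). -/
/-- The PolySoft loss `ℓ_{λ,d}` on `[0,∞)` (here `lam` plays the role of `λ`). -/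
noncomputable def polySoftFn (lam d : ℝ) (u : ℝ) : ℝ :=
  if u < lam then ((d - 1) * lam / d) * (1 - (1 - u / lam) ^ (d / (d - 1)))
  else (d - 1) * lam / d

/-- The PolySoft loss dominates a multiple of the truncated identity. -/
theorem mul_min_le_polySoftFn {lam d u : ℝ} (hlam : 0 < lam) (hd : 1 < d) (hu : 0 ≤ u) :
    ((d - 1) / d) * min u lam ≤ polySoftFn lam d u := by
  have hd1 : 0 < d - 1 := by linarith
  have hd0 : 0 < d := by linarith
  unfold polySoftFn
  split_ifs with h
  · rw [min_eq_left h.le]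
    have hexp : 1 ≤ d / (d - 1) := by rw [le_div_iff₀ hd1]; linarith
    have hdiv : u / lam ≤ 1 := (div_le_one hlam).2 h.le
    have hpow : (1 - u / lam) ^ (d / (d - 1)) ≤ 1 - u / lam :=
      Real.rpow_le_self_of_le_one (by linarith) (by linarith [div_nonneg hu hlam.le]) hexp
    calc (d - 1) / d * u = (d - 1) * lam / d * (u / lam) := by field_simp
      _ ≤ _ := mul_le_mul_of_nonneg_left (by linarith) (by positivity)
  · rw [min_eq_right (not_lt.1 h)]
    exact (div_mul_eq_mul_div _ _ _).le

/-- Truncation is subadditive on nonnegative finite sums. -/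
theorem min_sum_le_sum_min {ι : Type*} (s : Finset ι) (f : ι → ℝ) (hf : ∀ i ∈ s, 0 ≤ f i)
    {a : ℝ} (ha : 0 ≤ a) : min (∑ i ∈ s, f i) a ≤ ∑ i ∈ s, min (f i) a := by
  by_cases h : ∃ i ∈ s, a ≤ f i
  · obtain ⟨i, hi, hai⟩ := h
    calc min (∑ i ∈ s, f i) a ≤ min (f i) a := by rw [min_eq_right hai]; exact min_le_right _ _
      _ ≤ _ := Finset.single_le_sum (f := fun i => min (f i) a)
        (fun j hj => le_min (hf j hj) ha) hi
  · push Not at h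
    rw [Finset.sum_congr rfl fun i hi => min_eq_left (h i hi).le]
    exact min_le_left _ _

/-- The sum of the log-losses over all labels is minimal at the uniform prediction. -/
theorem IsPred.mul_log_le_sum_neg_log {c : ℕ} (hc : 0 < c) {p : Fin c → ℝ} (hp : IsPred c p)
    (hpos : ∀ j, 0 < p j) : (c : ℝ) * Real.log c ≤ ∑ j, -Real.log (p j) := by
  have hc' : (0 : ℝ) < c := by exact_mod_cast hc
  have hle : ∀ j, Real.log c + (1 - c * p j) ≤ -Real.log (p j) := fun j => by
    have := Real.log_le_sub_one_of_pos (mul_pos hc' (hpos j))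
    rw [Real.log_mul hc'.ne' (hpos j).ne'] at this
    linarith
  refine le_trans (le_of_eq ?_) (Finset.sum_le_sum fun j _ => hle j)
  simp [Finset.sum_add_distrib, ← Finset.mul_sum, hp.2]

/-- Lower bound on the sum over labels of the PolySoft classification losses. -/
theorem polySoft_sum_lower_bound {c : ℕ} (hc : 2 ≤ c) (lam d : ℝ)
    (hlam : 0 < lam) (hd : 1 < d)
    (p : Fin c → ℝ) (hp : IsPred c p) (hpos : ∀ j, 0 < p j) :
    ((d - 1) / d) * min ((c : ℝ) * Real.log c) lam ≤
      ∑ j, polySoftFn lam d (-Real.log (p j)) := by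
  have hnonneg : ∀ j, 0 ≤ -Real.log (p j) := fun j => by
    have : p j ≤ 1 := hp.2 ▸ Finset.single_le_sum (fun i _ => hp.1 i) (Finset.mem_univ j)
    linarith [Real.log_nonpos (hp.1 j) this]
  calc ((d - 1) / d) * min ((c : ℝ) * Real.log c) lam
      ≤ ((d - 1) / d) * ∑ j, min (-Real.log (p j)) lam :=
        mul_le_mul_of_nonneg_left
          ((min_le_min_right _ (hp.mul_log_le_sum_neg_log (by omega) hpos)).trans
            (min_sum_le_sum_min _ _ (fun j _ => hnonneg j) hlam.le))
          (div_nonneg (by linarith) (by linarith))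
    _ = ∑ j, ((d - 1) / d) * min (-Real.log (p j)) lam := Finset.mul_sum _ _ _
    _ ≤ _ := Finset.sum_le_sum fun j _ => mul_min_le_polySoftFn hlam hd (hnonneg j)
end

section
/- Let c ≥ 2 be an integer and 0 ≤ t1 < 1. For every prediction p and every label j ∈ {1,…,c}, the Bi-Tempered loss is bounded: 0 ≤ L_Bi(p, j) ≤ 1/(1−t1) + (1 − c^{t1−1})/(2−t1). -/
theorem IsPred.le_one_s18 {c : ℕ} {p : Fin c → ℝ} (hp : IsPred c p) (k : Fin c) : p k ≤ 1 := by
  rw [← hp.2]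
  exact Finset.single_le_sum (fun i _ => hp.1 i) (Finset.mem_univ k)

/-- The sum of the `q`-th powers of a prediction is at most one. -/
theorem IsPred.sum_rpow_le_one_s18 {c : ℕ} {p : Fin c → ℝ} (hp : IsPred c p) {q : ℝ} (hq : 1 ≤ q) :
    ∑ k, (p k) ^ q ≤ 1 := by
  rw [← hp.2]
  refine Finset.sum_le_sum fun k _ => Real.rpow_le_self_of_le_one (hp.1 k) (hp.le_one_s18 k) hq

/-- The sum of the `q`-th powers of a prediction is at least its value at the uniform vector. -/
theorem IsPred.rpow_le_sum_rpow {c : ℕ} (hc : 0 < c) {p : Fin c → ℝ} (hp : IsPred c p) {q : ℝ}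
    (hq : 1 ≤ q) : (c : ℝ) ^ (1 - q) ≤ ∑ k, (p k) ^ q := by
  have hc' : (0 : ℝ) < c := by exact_mod_cast hc
  have h := Real.rpow_sum_le_const_mul_sum_rpow_of_nonneg Finset.univ hq (fun i _ => hp.1 i)
  rw [hp.2, Real.one_rpow, Finset.card_univ, Fintype.card_fin] at h
  rw [← neg_sub q 1, Real.rpow_neg hc'.le]
  exact (inv_le_iff_one_le_mul₀' (Real.rpow_pos_of_pos hc' _)).mpr h

theorem tLog_nonpos {t x : ℝ} (ht : t < 1) (hx : 0 ≤ x) (hx1 : x ≤ 1) : tLog t x ≤ 0 :=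
  div_nonpos_of_nonpos_of_nonneg
    (sub_nonpos.mpr (Real.rpow_le_one hx hx1 (sub_pos.mpr ht).le)) (sub_pos.mpr ht).le

theorem neg_tLog_le {t x : ℝ} (ht : t < 1) (hx : 0 ≤ x) : -tLog t x ≤ 1 / (1 - t) := by
  rw [tLog, ← neg_div]
  exact div_le_div_of_nonneg_right (by linarith [Real.rpow_nonneg hx (1 - t)])
    (sub_pos.mpr ht).le

/-- The Bi-Tempered loss is bounded. -/
theorem biLoss_bounded {c : ℕ} (hc : 2 ≤ c) (t1 : ℝ) (ht0 : 0 ≤ t1) (ht1 : t1 < 1)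
    (p : Fin c → ℝ) (hp : IsPred c p) (j : Fin c) :
    0 ≤ biLoss t1 p j ∧
    biLoss t1 p j ≤ 1 / (1 - t1) + (1 - (c : ℝ) ^ (t1 - 1)) / (2 - t1) := by
  have hq : 1 ≤ 2 - t1 := by linarith
  have hpos : 0 < 2 - t1 := by linarith
  constructor
  · exact add_nonneg (neg_nonneg.mpr (tLog_nonpos ht1 (hp.1 j) (hp.le_one_s18 j)))
      (mul_nonneg (by positivity) (sub_nonneg.mpr (hp.sum_rpow_le_one_s18 hq)))
  · refine add_le_add (neg_tLog_le ht1 (hp.1 j)) ?_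
    have h := hp.rpow_le_sum_rpow (by omega) hq
    rw [show 1 - (2 - t1) = t1 - 1 by ring] at h
    rw [one_div_mul_eq_div]
    gcongr
end
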